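/- Let C be a unital C*-algebra, A ⊆ C a closed subalgebra, K a simple unital C*-algebra, and suppose in the (spatial) tensor product C ⊗ K the subalgebra A ⊗ K satisfies (A⊗K)*·(A⊗K) ⊆ closure(A⊗K + (A⊗K)*). Then for any projection p ∈ K, compression by 1⊗p shows A*·A ⊗ p ⊆ closure((A + A*) ⊗ p); in particular A*·A ⊆ closure(A + A*) in C. -/

import Mathlib

open scoped Pointwise

section Excision

variable {K : Type*} [CStarAlgebra K] [PartialOrder K] [StarOrderedRing K]

/-- An element on which every continuous positive real-linear functional is nonnegative is
itself nonnegative. -/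
theorem CStarAlgebra.nonneg_of_forall_functional_nonneg {z : K}
    (h : ∀ φ : K →L[ℝ] ℝ, (∀ a, 0 ≤ a → 0 ≤ φ a) → 0 ≤ φ z) : 0 ≤ z := by
  by_contra hz
  obtain ⟨f, hf, hfz⟩ := (ProperCone.positive ℝ K).hyperplane_separation_point
    (x₀ := z) (by simpa using hz)
  exact absurd (h f fun a ha ↦ hf a (by simpa using ha)) (not_le.mpr hfz)

theorem CStarAlgebra.abs_functional_le {φ : K →L[ℝ] ℝ} (hφ : ∀ a, 0 ≤ a → 0 ≤ φ a) {k : K}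
    (hk : IsSelfAdjoint k) : |φ k| ≤ ‖k‖ * φ 1 := by
  have h1 := hφ _ (sub_nonneg.mpr hk.le_algebraMap_norm_self)
  have h2 := hφ _ (sub_nonneg.mpr hk.neg_algebraMap_norm_le_self)
  simp only [map_sub, map_neg, Algebra.algebraMap_eq_smul_one, map_smul, smul_eq_mul] at h1 h2
  exact abs_le.mpr ⟨by linarith, by linarith⟩

theorem CStarAlgebra.norm_le_three_mul_of_le_of_neg_le {z : K} {r : ℝ} (hr : 0 ≤ r)
    (h1 : z ≤ algebraMap ℝ K r) (h2 : -algebraMap ℝ K r ≤ z) : ‖z‖ ≤ 3 * r := by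
  rcases subsingleton_or_nontrivial K with hK | hK
  · rw [Subsingleton.elim z 0, norm_zero]
    positivity
  have h3 : 0 ≤ z + algebraMap ℝ K r := neg_le_iff_add_nonneg.mp h2
  have h4 : ‖z + algebraMap ℝ K r‖ ≤ 2 * r := by
    rw [CStarAlgebra.norm_le_iff_le_algebraMap _ (by positivity) h3, two_mul, map_add]
    gcongr
  have h5 : ‖algebraMap ℝ K r‖ = r := by
    rw [norm_algebraMap', Real.norm_of_nonneg hr]
  calc ‖z‖ = ‖(z + algebraMap ℝ K r) - algebraMap ℝ K r‖ := by rw [add_sub_cancel_right]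
    _ ≤ ‖z + algebraMap ℝ K r‖ + ‖algebraMap ℝ K r‖ := norm_sub_le _ _
    _ ≤ 3 * r := by linarith

/-- For finitely many self-adjoint elements there is a state whose joint value `x` is almost
exposed by the functional `y ↦ ∑ i, x i * y i` on the joint numerical range. -/
theorem CStarAlgebra.exists_almost_exposed_state [Nontrivial K] {ι : Type*} [Fintype ι]
    (k : ι → K) (hk : ∀ i, IsSelfAdjoint (k i)) {η : ℝ} (hη : 0 < η) :
    ∃ (φ : K →L[ℝ] ℝ) (t : ℝ), (∀ a, 0 ≤ a → 0 ≤ φ a) ∧ φ 1 = 1 ∧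
      t < φ (∑ i, φ (k i) • k i) ∧
      ∀ ψ : K →L[ℝ] ℝ, (∀ a, 0 ≤ a → 0 ≤ ψ a) → t * ψ 1 ≤ ψ (∑ i, φ (k i) • k i) →
        ∀ i, |ψ (k i) - φ (k i) * ψ 1| ≤ η * ψ 1 := by
  have hone : (0 : K) ≤ 1 := zero_le_one
  have normalize : ∀ ψ : K →L[ℝ] ℝ, (∀ a, 0 ≤ a → 0 ≤ ψ a) → 0 < ψ 1 →
      (∀ a, 0 ≤ a → 0 ≤ ((ψ 1)⁻¹ • ψ) a) ∧ ((ψ 1)⁻¹ • ψ) 1 = 1 := fun ψ hψ h1 ↦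
    ⟨fun a ha ↦ mul_nonneg (inv_nonneg.mpr h1.le) (hψ a ha), inv_mul_cancel₀ h1.ne'⟩
  let S : Set ℝ := {r | ∃ φ : K →L[ℝ] ℝ, (∀ a, 0 ≤ a → 0 ≤ φ a) ∧ φ 1 = 1 ∧
    r = ∑ i, φ (k i) ^ 2}
  have hbdd : BddAbove S := by
    refine ⟨∑ i, ‖k i‖ ^ 2, ?_⟩
    rintro _ ⟨φ, hφ, h1, rfl⟩
    refine Finset.sum_le_sum fun i _ ↦ ?_
    have := CStarAlgebra.abs_functional_le hφ (hk i)
    rw [h1, mul_one] at this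
    exact sq_le_sq' (abs_le.mp this).1 (abs_le.mp this).2
  have hne : S.Nonempty := by
    have hneg : ¬ (0 : K) ≤ -1 := fun h ↦
      one_ne_zero (le_antisymm (neg_nonneg.mp h) hone)
    obtain ⟨ψ, hψ, hψ1⟩ : ∃ ψ : K →L[ℝ] ℝ, (∀ a, 0 ≤ a → 0 ≤ ψ a) ∧ ψ (-1) < 0 := by
      by_contra! hcon
      exact hneg (CStarAlgebra.nonneg_of_forall_functional_nonneg hcon)
    obtain ⟨h1, h2⟩ := normalize ψ hψ (by simpa using hψ1)
    exact ⟨_, _, h1, h2, rfl⟩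
  obtain ⟨_, ⟨φ, hφ, hφ1, rfl⟩, hlt⟩ := exists_lt_of_lt_csSup hne
    (show sSup S - η ^ 2 / 4 < sSup S by linarith [pow_pos hη 2])
  have hval : ∀ ψ : K →L[ℝ] ℝ, ψ (∑ i, φ (k i) • k i) = ∑ i, φ (k i) * ψ (k i) := fun ψ ↦ by
    simp only [map_sum, map_smul, smul_eq_mul]
  have hstate : ∀ ψ : K →L[ℝ] ℝ, (∀ a, 0 ≤ a → 0 ≤ ψ a) → ψ 1 = 1 →
      sSup S - η ^ 2 / 2 ≤ ψ (∑ i, φ (k i) • k i) → ∀ i, |ψ (k i) - φ (k i)| ≤ η := by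
    intro ψ hψ hψ1 ht i
    rw [hval] at ht
    have hψS : ∑ i, ψ (k i) ^ 2 ≤ sSup S := le_csSup hbdd ⟨ψ, hψ, hψ1, rfl⟩
    have hφS : ∑ i, φ (k i) ^ 2 ≤ sSup S := le_csSup hbdd ⟨φ, hφ, hφ1, rfl⟩
    refine abs_le_of_sq_le_sq ?_ hη.le
    calc (ψ (k i) - φ (k i)) ^ 2 ≤ ∑ i, (ψ (k i) - φ (k i)) ^ 2 :=
          Finset.single_le_sum (f := fun i ↦ (ψ (k i) - φ (k i)) ^ 2)
            (fun _ _ ↦ sq_nonneg _) (Finset.mem_univ i)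
      _ = ∑ i, ψ (k i) ^ 2 + ∑ i, φ (k i) ^ 2 - 2 * ∑ i, φ (k i) * ψ (k i) := by
          rw [Finset.mul_sum, ← Finset.sum_add_distrib, ← Finset.sum_sub_distrib]
          exact Finset.sum_congr rfl fun _ _ ↦ by ring
      _ ≤ η ^ 2 := by linarith
  refine ⟨φ, sSup S - η ^ 2 / 2, hφ, hφ1, ?_, fun ψ hψ ht i ↦ ?_⟩
  · rw [hval]
    simp only [← sq]
    linarith [pow_pos hη 2]
  · rcases (hψ 1 hone).eq_or_lt with h0 | h0
    · have := CStarAlgebra.abs_functional_le hψ (hk i)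
      simpa [← h0] using this
    · obtain ⟨h1, h2⟩ := normalize ψ hψ h0
      have h3 := hstate _ h1 h2 (by
        rw [_root_.smul_apply, smul_eq_mul, inv_mul_eq_div, le_div_iff₀ h0]
        exact ht) i
      rw [_root_.smul_apply, smul_eq_mul] at h3
      calc |ψ (k i) - φ (k i) * ψ 1| = |(ψ 1)⁻¹ * ψ (k i) - φ (k i)| * ψ 1 := by
            rw [← abs_of_pos h0, ← abs_mul, abs_of_pos h0, sub_mul, mul_right_comm,
              inv_mul_cancel₀ h0.ne', one_mul]
        _ ≤ η * ψ 1 := by gcongr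

/-- Approximate excision: finitely many self-adjoint elements are compressed to almost scalar
multiples of `e * e` by a common positive element `e` of norm one. -/
theorem CStarAlgebra.exists_excision [Nontrivial K] {ι : Type*} [Fintype ι]
    (k : ι → K) (hk : ∀ i, IsSelfAdjoint (k i)) {η : ℝ} (hη : 0 < η) :
    ∃ e : K, 0 ≤ e ∧ ‖e‖ = 1 ∧ ∃ x : ι → ℝ, ∀ i, ‖e * k i * e - x i • (e * e)‖ ≤ η := by
  obtain ⟨φ, t, hφ, hφ1, hφt, hmain⟩ :=
    CStarAlgebra.exists_almost_exposed_state k hk (η := η / 3) (by positivity)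
  set h : K := ∑ i, φ (k i) • k i with hh
  have hsa : IsSelfAdjoint h := by
    rw [hh]
    exact isSelfAdjoint_sum _ fun i _ ↦ (IsSelfAdjoint.all (φ (k i))).smul (hk i)
  set y : K := h - algebraMap ℝ K t with hy
  have hysa : IsSelfAdjoint y := hsa.sub ((IsSelfAdjoint.all t).algebraMap K)
  set g : K := y⁺ with hg
  have hg0 : 0 ≤ g := CFC.posPart_nonneg y
  have hgne : g ≠ 0 := by
    intro h0
    have h1 : y ≤ 0 := (CFC.posPart_eq_zero_iff y hysa).mp h0
    have h2 := hφ (-y) (neg_nonneg.mpr h1)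
    rw [hy] at h2
    simp only [map_neg, map_sub, Algebra.algebraMap_eq_smul_one, map_smul, hφ1,
      smul_eq_mul] at h2
    linarith
  have hgyg : 0 ≤ g * y * g := by
    have : g * y = g * g := by
      conv_lhs => rw [← CFC.posPart_sub_negPart y hysa]
      rw [mul_sub, hg, CFC.posPart_mul_negPart, sub_zero]
    rw [this]
    exact (IsSelfAdjoint.of_nonneg hg0).conjugate_nonneg hg0
  have hgn : 0 < ‖g‖ := norm_pos_iff.mpr hgne
  set e : K := ‖g‖⁻¹ • g with he
  have he0 : 0 ≤ e := smul_nonneg (by positivity) hg0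
  have hesa : IsSelfAdjoint e := .of_nonneg he0
  have hen : ‖e‖ = 1 := by
    rw [he, norm_smul, norm_inv, norm_norm, inv_mul_cancel₀ hgn.ne']
  have hehe : 0 ≤ e * y * e := by
    rw [he, smul_mul_assoc, smul_mul_assoc, mul_smul_comm]
    exact smul_nonneg (by positivity) (smul_nonneg (by positivity) hgyg)
  clear_value e
  have hee : e * e ≤ 1 := by
    have h1 : ‖e * e‖ ≤ 1 := (norm_mul_le _ _).trans (by simp [hen])
    exact (CStarAlgebra.norm_le_one_iff_of_nonneg _ hesa.mul_self_nonneg).mp h1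
  have key : ∀ φ' : K →L[ℝ] ℝ, (∀ a, 0 ≤ a → 0 ≤ φ' a) → ∀ i,
      |φ' (e * k i * e) - φ (k i) * φ' (e * e)| ≤ η / 3 * φ' (e * e) := by
    intro φ' hφ' i
    have := hmain (φ' ∘L ContinuousLinearMap.mulLeftRight ℝ K e e)
      (fun a ha ↦ hφ' _ (by simpa using hesa.conjugate_nonneg ha)) (by
        have h2 := hφ' _ hehe
        rw [hy, mul_sub, sub_mul, Algebra.algebraMap_eq_smul_one, mul_smul_comm,
          smul_mul_assoc, map_sub, map_smul, smul_eq_mul] at h2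
        simpa using h2) i
    simpa using this
  have hbound : (η / 3) • (e * e) ≤ algebraMap ℝ K (η / 3) := by
    rw [Algebra.algebraMap_eq_smul_one]
    exact smul_le_smul_of_nonneg_left hee (by positivity)
  refine ⟨e, he0, hen, fun i ↦ φ (k i), fun i ↦ ?_⟩
  rw [show η = 3 * (η / 3) by ring]
  apply CStarAlgebra.norm_le_three_mul_of_le_of_neg_le (by positivity)
  · refine le_trans (sub_nonneg.mp ?_) hbound
    refine CStarAlgebra.nonneg_of_forall_functional_nonneg fun φ' hφ' ↦ ?_
    have := abs_le.mp (key φ' hφ' i)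
    simp only [map_sub, map_smul, smul_eq_mul]
    linarith
  · refine le_trans (neg_le_neg hbound) (sub_nonneg.mp ?_)
    refine CStarAlgebra.nonneg_of_forall_functional_nonneg fun φ' hφ' ↦ ?_
    have := abs_le.mp (key φ' hφ' i)
    simp only [map_sub, map_neg, map_smul, smul_eq_mul]
    linarith

end Excision

section TensorProduct

variable {C K E : Type*} [CStarAlgebra C] [CStarAlgebra K] [CStarAlgebra E]

/-- The span of the elementary tensors `s ⊗ k` with `s` in a given subspace and `k`
self-adjoint. -/
noncomputable def selfAdjointTensorSpan (ιC : C →⋆ₐ[ℂ] E) (ιK : K →⋆ₐ[ℂ] E) (S : Submodule ℂ C) :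
    Submodule ℂ E :=
  Submodule.span ℂ {e : E | ∃ s ∈ S, ∃ k, IsSelfAdjoint k ∧ e = ιC s * ιK k}

theorem exists_sum_of_mem_selfAdjointTensorSpan {ιC : C →⋆ₐ[ℂ] E} {ιK : K →⋆ₐ[ℂ] E}
    {S : Submodule ℂ C} {y : E} (hy : y ∈ selfAdjointTensorSpan ιC ιK S) :
    ∃ (n : ℕ) (s : Fin n → C) (k : Fin n → K), (∀ i, s i ∈ S) ∧ (∀ i, IsSelfAdjoint (k i)) ∧
      y = ∑ i, ιC (s i) * ιK (k i) := by
  obtain ⟨n, f, g, rfl⟩ := Submodule.mem_span_set'.mp hy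
  choose s hs k hk hg using fun i ↦ (g i).2
  exact ⟨n, fun i ↦ f i • s i, k, fun i ↦ S.smul_mem _ (hs i), hk,
    Finset.sum_congr rfl fun i _ ↦ by rw [hg, map_smul, smul_mul_assoc]⟩

theorem mul_mem_selfAdjointTensorSpan (ιC : C →⋆ₐ[ℂ] E) (ιK : K →⋆ₐ[ℂ] E)
    {S : Submodule ℂ C} {s : C} (hs : s ∈ S) (k : K) :
    ιC s * ιK k ∈ selfAdjointTensorSpan ιC ιK S := by
  have h : ιC s * ιK k =
      ιC s * ιK (realPart k : K) + ιC (Complex.I • s) * ιK (imaginaryPart k : K) := by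
    conv_lhs => rw [← realPart_add_I_smul_imaginaryPart k]
    rw [map_add, mul_add, map_smul, map_smul, smul_mul_assoc, mul_smul_comm]
  rw [h]
  exact Submodule.add_mem _
    (Submodule.subset_span ⟨s, hs, _, (realPart k).2, rfl⟩)
    (Submodule.subset_span ⟨_, S.smul_mem _ hs, _, (imaginaryPart k).2, rfl⟩)

/-- If `c ⊗ 1` lies in the closure of `S ⊗ K`, then `c` lies in the closure of `S`. -/
theorem mem_closure_of_mem_closure_selfAdjointTensorSpan [Nontrivial K]
    {ιC : C →⋆ₐ[ℂ] E} {ιK : K →⋆ₐ[ℂ] E}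
    (hcomm : ∀ (c : C) (k : K), Commute (ιC c) (ιK k))
    (hnorm : ∀ (c : C) (k : K), ‖ιC c * ιK k‖ = ‖c‖ * ‖k‖)
    {S : Submodule ℂ C} {c : C}
    (hc : ιC c ∈ closure (selfAdjointTensorSpan ιC ιK S : Set E)) :
    c ∈ closure (S : Set C) := by
  let _ := CStarAlgebra.spectralOrder K
  let _ := CStarAlgebra.spectralOrderedRing K
  rw [Metric.mem_closure_iff] at hc ⊢
  intro ε hε
  obtain ⟨y, hy, hcy⟩ := hc (ε / 2) (by positivity)
  obtain ⟨n, s, k, hs, hk, rfl⟩ := exists_sum_of_mem_selfAdjointTensorSpan hy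
  set M : ℝ := ∑ i, ‖s i‖ with hM
  have hM0 : 0 ≤ M := Finset.sum_nonneg fun _ _ ↦ norm_nonneg _
  obtain ⟨e, he0, hen, x, hx⟩ :=
    CStarAlgebra.exists_excision k hk (η := ε / (2 * (M + 1))) (by positivity)
  have hesa : IsSelfAdjoint e := .of_nonneg he0
  have hee : ‖e * e‖ = 1 := by
    have := CStarRing.norm_star_mul_self (x := e)
    rwa [hesa.star_eq, hen, mul_one] at this
  have hιe : ‖ιK e‖ ≤ 1 := hen ▸ NonUnitalStarAlgHom.norm_apply_le ιK e
  refine ⟨∑ i, (x i : ℂ) • s i, S.sum_mem fun i _ ↦ S.smul_mem _ (hs i), ?_⟩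
  have hconj : ∀ (a : C) (b : K), ιK e * (ιC a * ιK b) * ιK e = ιC a * ιK (e * b * e) := by
    intro a b
    rw [← mul_assoc, ← (hcomm a e).eq, map_mul, map_mul]
    simp only [mul_assoc]
  have hsplit : ιC (c - ∑ i, (x i : ℂ) • s i) * ιK (e * e) =
      ιK e * (ιC c - ∑ i, ιC (s i) * ιK (k i)) * ιK e +
        ∑ i, ιC (s i) * ιK (e * k i * e - x i • (e * e)) := by
    have h1 : ιK e * ιC c * ιK e = ιC c * ιK (e * e) := by
      simpa using hconj c 1
    rw [mul_sub, sub_mul, h1, Finset.mul_sum, Finset.sum_mul]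
    simp only [hconj, map_sub, mul_sub, Finset.sum_sub_distrib, sub_mul, map_sum, map_smul,
      Finset.sum_mul, smul_mul_assoc]
    have h2 : ∀ i, ιC (s i) * ιK (x i • (e * e)) = (x i : ℂ) • (ιC (s i) * ιK (e * e)) := by
      intro i
      rw [← Complex.coe_smul, map_smul, mul_smul_comm]
    simp only [h2]
    abel
  rw [dist_eq_norm] at hcy ⊢
  calc ‖c - ∑ i, (x i : ℂ) • s i‖
      = ‖ιC (c - ∑ i, (x i : ℂ) • s i) * ιK (e * e)‖ := by rw [hnorm, hee, mul_one]
    _ ≤ ‖ιK e * (ιC c - ∑ i, ιC (s i) * ιK (k i)) * ιK e‖ +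
        ∑ i, ‖s i‖ * (ε / (2 * (M + 1))) := by
      rw [hsplit]
      refine (norm_add_le _ _).trans (add_le_add le_rfl ((norm_sum_le _ _).trans ?_))
      refine Finset.sum_le_sum fun i _ ↦ ?_
      rw [hnorm]
      exact mul_le_mul_of_nonneg_left (hx i) (norm_nonneg _)
    _ ≤ ‖ιC c - ∑ i, ιC (s i) * ιK (k i)‖ + M * (ε / (2 * (M + 1))) := by
      rw [← Finset.sum_mul, ← hM]
      refine add_le_add ?_ le_rfl
      calc _ ≤ ‖ιK e‖ * ‖ιC c - ∑ i, ιC (s i) * ιK (k i)‖ * ‖ιK e‖ := norm_mul₃_le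
        _ ≤ 1 * ‖ιC c - ∑ i, ιC (s i) * ιK (k i)‖ * 1 := by gcongr
        _ = _ := by rw [one_mul, mul_one]
    _ < ε / 2 + ε / 2 := by
      refine add_lt_add_of_lt_of_le hcy ?_
      rw [mul_div_assoc', div_le_div_iff₀ (by positivity) (by positivity)]
      nlinarith
    _ = ε := add_halves ε

theorem star_mul_mem_closure_of_tensor [Nontrivial K]
    {ιC : C →⋆ₐ[ℂ] E} {ιK : K →⋆ₐ[ℂ] E}
    (hcomm : ∀ (c : C) (k : K), Commute (ιC c) (ιK k))
    (hnorm : ∀ (c : C) (k : K), ‖ιC c * ιK k‖ = ‖c‖ * ‖k‖)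
    {A : NonUnitalSubalgebra ℂ C} {AK : Set E}
    (hAK : AK = closure (Submodule.span ℂ {e : E | ∃ a ∈ A, ∃ k, e = ιC a * ιK k} : Set E))
    (hsD : star '' AK * AK ⊆ closure (AK + star '' AK)) {a b : C} (ha : a ∈ A) (hb : b ∈ A) :
    star a * b ∈ closure ((A : Set C) + star '' (A : Set C)) := by
  let S : Submodule ℂ C :=
    A.toSubmodule ⊔ A.toSubmodule.map ((starLinearEquiv ℂ : C ≃ₗ⋆[ℂ] C) : C →ₗ⋆[ℂ] C)
  have hS : (S : Set C) = (A : Set C) + star '' (A : Set C) := by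
    rw [Submodule.coe_sup, Submodule.map_coe]
    rfl
  have hAS : ∀ u ∈ A, u ∈ S := fun u hu ↦ Submodule.mem_sup_left hu
  have hAS' : ∀ u ∈ A, star u ∈ S := fun u hu ↦ Submodule.mem_sup_right ⟨u, hu, rfl⟩
  let D : Submodule ℂ E := (selfAdjointTensorSpan ιC ιK S).topologicalClosure
  have hAKD : AK ⊆ D := by
    rw [hAK]
    refine closure_minimal ?_ (Submodule.isClosed_topologicalClosure _)
    refine SetLike.coe_subset_coe.mpr (Submodule.span_le.mpr ?_)
    rintro _ ⟨u, hu, k, rfl⟩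
    exact Submodule.le_topologicalClosure _ (mul_mem_selfAdjointTensorSpan ιC ιK (hAS u hu) k)
  have hAKD' : AK ⊆ star ⁻¹' (D : Set E) := by
    rw [hAK]
    refine closure_minimal ?_
      ((Submodule.isClosed_topologicalClosure _).preimage continuous_star)
    change (Submodule.span ℂ _ : Submodule ℂ E) ≤
      D.comap ((starLinearEquiv ℂ : E ≃ₗ⋆[ℂ] E) : E →ₗ⋆[ℂ] E)
    refine Submodule.span_le.mpr ?_
    rintro _ ⟨u, hu, k, rfl⟩
    change star (ιC u * ιK k) ∈ D
    rw [(hcomm u k).eq, star_mul, ← map_star, ← map_star]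
    exact Submodule.le_topologicalClosure _
      (mul_mem_selfAdjointTensorSpan ιC ιK (hAS' u hu) (star k))
  have hmem : ∀ u ∈ A, ιC u ∈ AK := fun u hu ↦ by
    rw [hAK]
    exact subset_closure (Submodule.subset_span ⟨u, hu, 1, by rw [map_one, mul_one]⟩)
  have hD : ιC (star a * b) ∈ D := by
    have h1 := hsD (Set.mul_mem_mul (Set.mem_image_of_mem star (hmem a ha)) (hmem b hb))
    rw [map_mul, map_star]
    refine closure_minimal ?_ (Submodule.isClosed_topologicalClosure _) h1
    rintro _ ⟨u, hu, _, ⟨v, hv, rfl⟩, rfl⟩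
    exact D.add_mem (hAKD hu) (hAKD' hv)
  rw [← hS]
  exact mem_closure_of_mem_closure_selfAdjointTensorSpan hcomm hnorm hD

end TensorProduct

/-- If `A ⊗ K` is semi-Dirichlet in `C ⊗ K` (spatial tensor product, axiomatized by
commuting embeddings with the cross-norm property and dense span of elementary tensors)
with `K` simple and unital, then compressing by `1 ⊗ p` for a nonzero projection `p ∈ K`
shows `A*·A ⊗ p ⊆ closure((A+A*) ⊗ p)`; in particular `A` is semi-Dirichlet in `C`. -/
theorem stmt_15 {C K E : Type*}
    [NormedRing C] [StarRing C] [CStarRing C] [NormedAlgebra ℂ C] [CompleteSpace C]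
    [StarModule ℂ C]
    [NormedRing K] [StarRing K] [CStarRing K] [NormedAlgebra ℂ K] [CompleteSpace K]
    [StarModule ℂ K]
    [NormedRing E] [StarRing E] [CStarRing E] [NormedAlgebra ℂ E] [CompleteSpace E]
    [StarModule ℂ E]
    -- `K` is (topologically) simple:
    (hK : ∀ I : TwoSidedIdeal K, IsClosed (I : Set K) → I = ⊥ ∨ I = ⊤)
    -- the two tensor-factor embeddings into `E = C ⊗ K`:
    (ιC : C →⋆ₐ[ℂ] E) (ιK : K →⋆ₐ[ℂ] E)
    (hcomm : ∀ (c : C) (k : K), Commute (ιC c) (ιK k))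
    (hnorm : ∀ (c : C) (k : K), ‖ιC c * ιK k‖ = ‖c‖ * ‖k‖)
    (hgen : Dense (Submodule.span ℂ {e : E | ∃ c k, e = ιC c * ιK k} : Set E))
    (A : NonUnitalSubalgebra ℂ C) (hA : IsClosed (A : Set C))
    -- `A ⊗ K`:
    (AK : Set E)
    (hAK : AK = closure (Submodule.span ℂ {e : E | ∃ a ∈ A, ∃ k, e = ιC a * ιK k} : Set E))
    (hsD : star '' AK * AK ⊆ closure (AK + star '' AK))
    (p : K) (hp : p ≠ 0) (hpstar : star p = p) (hpidem : p * p = p) :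
    (∀ a ∈ A, ∀ b ∈ A,
        ιC (star a * b) * ιK p ∈
          closure {e : E | ∃ s ∈ (A : Set C) + star '' (A : Set C), e = ιC s * ιK p}) ∧
      (star '' (A : Set C)) * (A : Set C) ⊆ closure ((A : Set C) + star '' (A : Set C)) := by
  let _ : CStarAlgebra C := {}
  let _ : CStarAlgebra K := {}
  let _ : CStarAlgebra E := {}
  have : Nontrivial K := ⟨⟨p, 0, hp⟩⟩
  have hmain : ∀ a ∈ A, ∀ b ∈ A,
      star a * b ∈ closure ((A : Set C) + star '' (A : Set C)) := fun a ha b hb ↦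
    star_mul_mem_closure_of_tensor hcomm hnorm hAK hsD ha hb
  refine ⟨fun a ha b hb ↦ ?_, ?_⟩
  · have hcont : Continuous fun c : C ↦ ιC c * ιK p :=
      (AddMonoidHomClass.continuous_of_bound ιC 1 fun c ↦ by
        simpa using NonUnitalStarAlgHom.norm_apply_le ιC c).mul continuous_const
    exact map_mem_closure (f := fun c : C ↦ ιC c * ιK p) hcont (hmain a ha b hb) fun s hs ↦ ⟨s, hs, rfl⟩
  · rintro _ ⟨_, ⟨a, ha, rfl⟩, b, hb, rfl⟩
    exact hmain a ha b hb
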